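/- arXiv:1104.4779 — 7 statements merged into one kernel-verified Lean document; each statement's English description precedes it below -/
import Mathlib

section
/- Let A=(A;R1,R2,R3,R4) be an instance, G its D-graph, and G'' the semi-compactor of G. Then the following statements are equivalent: (i) G retracts to the reflexive 4-cycle H; (ii) G'' retracts to H; (iii) G'' admits a compaction to H; (iv) G'' admits a vertex-surjective homomorphism to H. -/
namespace Paper

/-- The relation `S1 = {(0,3),(1,1),(3,1),(3,3)}`. -/
def S1 : Set (ℕ × ℕ) := {(0, 3), (1, 1), (3, 1), (3, 3)}

/-- The relation `S2 = {(1,0),(1,1),(3,1),(3,3)}`. -/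
def S2 : Set (ℕ × ℕ) := {(1, 0), (1, 1), (3, 1), (3, 3)}

/-- The relation `S3 = {(1,3),(3,1),(3,3)}`. -/
def S3 : Set (ℕ × ℕ) := {(1, 3), (3, 1), (3, 3)}

/-- The relation `S4 = {(1,1),(1,3),(3,1)}`. -/
def S4 : Set (ℕ × ℕ) := {(1, 1), (1, 3), (3, 1)}

/-- The domain `{0,1,3}` of the structure `D`. -/
def Dom : Set ℕ := {0, 1, 3}

/-- An instance: four binary relations on a set `α` such that every element
occurs in at least one pair of `R1 ∪ R2 ∪ R3 ∪ R4`. -/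
structure Inst (α : Type) : Type where
  R1 : Set (α × α)
  R2 : Set (α × α)
  R3 : Set (α × α)
  R4 : Set (α × α)
  cover : ∀ a : α, (∃ b, (a, b) ∈ R1 ∪ R2 ∪ R3 ∪ R4) ∨
    (∃ b, (b, a) ∈ R1 ∪ R2 ∪ R3 ∪ R4)

variable {α : Type}

/-- The set `L` of elements occurring as a first coordinate. -/
def Inst.L (I : Inst α) : Set α :=
  {p | ∃ q, (p, q) ∈ I.R1 ∪ I.R2 ∪ I.R3 ∪ I.R4}

/-- The set `R` of elements occurring as a second coordinate. -/
def Inst.Rs (I : Inst α) : Set α :=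
  {q | ∃ p, (p, q) ∈ I.R1 ∪ I.R2 ∪ I.R3 ∪ I.R4}

/-- The non-`H` vertices of the D-graph: the elements of `A`, the vertices
`a_p, b_p` for `p ∈ L` and the vertices `c_q, d_q` for `q ∈ R`. -/
abbrev Core (I : Inst α) : Type := α ⊕ ↥I.L ⊕ ↥I.L ⊕ ↥I.Rs ⊕ ↥I.Rs

/-- The vertex set of the D-graph: `h0,h1,h2,h3` (indexed by `ZMod 4`)
together with the non-`H` vertices. -/
abbrev DVert (I : Inst α) : Type := ZMod 4 ⊕ Core I

def ce (I : Inst α) (a : α) : Core I := Sum.inl a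
def ca (I : Inst α) (p : ↥I.L) : Core I := Sum.inr (Sum.inl p)
def cb (I : Inst α) (p : ↥I.L) : Core I := Sum.inr (Sum.inr (Sum.inl p))
def cc (I : Inst α) (q : ↥I.Rs) : Core I := Sum.inr (Sum.inr (Sum.inr (Sum.inl q)))
def cd (I : Inst α) (q : ↥I.Rs) : Core I := Sum.inr (Sum.inr (Sum.inr (Sum.inr q)))

/-- The vertex `h_i`. -/
def hv (I : Inst α) (i : ZMod 4) : DVert I := Sum.inl i
/-- The vertex corresponding to an element `a ∈ A`. -/
def ev (I : Inst α) (a : α) : DVert I := Sum.inr (ce I a)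
/-- The vertex `a_p` for `p ∈ L`. -/
def av (I : Inst α) (p : ↥I.L) : DVert I := Sum.inr (ca I p)
/-- The vertex `b_p` for `p ∈ L`. -/
def bv (I : Inst α) (p : ↥I.L) : DVert I := Sum.inr (cb I p)
/-- The vertex `c_q` for `q ∈ R`. -/
def cv (I : Inst α) (q : ↥I.Rs) : DVert I := Sum.inr (cc I q)
/-- The vertex `d_q` for `q ∈ R`. -/
def dv (I : Inst α) (q : ↥I.Rs) : DVert I := Sum.inr (cd I q)

/-- The (directed) list of edges of the D-graph. -/
def dBase (I : Inst α) : DVert I → DVert I → Prop := fun u v =>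
  (∃ i : ZMod 4, u = hv I i ∧ v = hv I (i + 1)) ∨
  (∃ p : ↥I.L,
    (u = av I p ∧ v = ev I ↑p) ∨ (u = bv I p ∧ v = ev I ↑p) ∨
    (u = av I p ∧ v = bv I p) ∨ (u = av I p ∧ v = hv I 0) ∨
    (u = av I p ∧ v = hv I 3) ∨ (u = bv I p ∧ v = hv I 1) ∨
    (u = bv I p ∧ v = hv I 2)) ∨
  (∃ q : ↥I.Rs,
    (u = cv I q ∧ v = ev I ↑q) ∨ (u = dv I q ∧ v = ev I ↑q) ∨
    (u = cv I q ∧ v = dv I q) ∨ (u = cv I q ∧ v = hv I 2) ∨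
    (u = cv I q ∧ v = hv I 3) ∨ (u = dv I q ∧ v = hv I 0) ∨
    (u = dv I q ∧ v = hv I 1)) ∨
  (∃ a : α, u = hv I 0 ∧ v = ev I a) ∨
  (∃ p q, (p, q) ∈ I.R1 ∧ ∃ hq : q ∈ I.Rs,
    ((u = cv I ⟨q, hq⟩ ∧ v = ev I p) ∨ (u = ev I q ∧ v = hv I 2))) ∨
  (∃ p q, (p, q) ∈ I.R2 ∧ ∃ hp : p ∈ I.L,
    ((u = ev I p ∧ v = hv I 2) ∨ (u = bv I ⟨p, hp⟩ ∧ v = ev I q))) ∨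
  (∃ p q, (p, q) ∈ I.R3 ∧ ∃ hp : p ∈ I.L, ∃ hq : q ∈ I.Rs,
    ((u = ev I p ∧ v = hv I 2) ∨ (u = ev I q ∧ v = hv I 2) ∨
     (u = av I ⟨p, hp⟩ ∧ v = cv I ⟨q, hq⟩))) ∨
  (∃ p q, (p, q) ∈ I.R4 ∧ ∃ hp : p ∈ I.L, ∃ hq : q ∈ I.Rs,
    ((u = ev I p ∧ v = hv I 2) ∨ (u = ev I q ∧ v = hv I 2) ∨
     (u = bv I ⟨p, hp⟩ ∧ v = dv I ⟨q, hq⟩))) ∨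
  (∃ p p' : ↥I.L, p ≠ p' ∧
    ((u = av I p ∧ v = av I p') ∨ (u = bv I p ∧ v = bv I p'))) ∨
  (∃ q q' : ↥I.Rs, q ≠ q' ∧
    ((u = cv I q ∧ v = cv I q') ∨ (u = dv I q ∧ v = dv I q')))

/-- The D-graph of an instance: the simple graph whose edges are exactly
the (symmetrised) pairs listed in `dBase`. -/
def DGraph (I : Inst α) : SimpleGraph (DVert I) := SimpleGraph.fromRel (dBase I)

/-- Adjacency in the reflexive 4-cycle `H` between *distinct* vertices
(`h_i h_{i+1}` cycle edges), vertices indexed by `ZMod 4`. -/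
def C4adj (x y : ZMod 4) : Prop := y = x + 1 ∨ x = y + 1

/-- A homomorphism from a simple graph `G` to the reflexive 4-cycle `H`:
every edge is mapped to a self-loop or to a cycle edge of `H`. -/
def IsHomC4 {V : Type} (G : SimpleGraph V) (f : V → ZMod 4) : Prop :=
  ∀ u v : V, G.Adj u v → f u = f v ∨ C4adj (f u) (f v)

/-- A retraction from the D-graph to `H`: a homomorphism fixing `h0,…,h3`. -/
def DRetr (I : Inst α) (g : DVert I → ZMod 4) : Prop :=
  IsHomC4 (DGraph I) g ∧ ∀ i : ZMod 4, g (hv I i) = i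

/-- A homomorphism from the instance `I` to the structure `D`. -/
def InstHom (I : Inst α) (f : α → ℕ) : Prop :=
  (∀ a : α, f a ∈ Dom) ∧
  (∀ p q, (p, q) ∈ I.R1 → (f p, f q) ∈ S1) ∧
  (∀ p q, (p, q) ∈ I.R2 → (f p, f q) ∈ S2) ∧
  (∀ p q, (p, q) ∈ I.R3 → (f p, f q) ∈ S3) ∧
  (∀ p q, (p, q) ∈ I.R4 → (f p, f q) ∈ S4)

/-- The ordered pairs `(v,v')` of non-`H` vertices of the D-graph for which an
`x`-vertex `x_{v,v'}` is created in the semi-compactor. -/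
def XPairs (I : Inst α) : Set (Core I × Core I) :=
  {pr : Core I × Core I |
    (∃ p : ↥I.L, pr = (ca I p, ce I ↑p) ∨ pr = (ce I ↑p, cb I p) ∨
      pr = (ca I p, cb I p)) ∨
    (∃ q : ↥I.Rs, pr = (ce I ↑q, cc I q) ∨ pr = (ce I ↑q, cd I q) ∨
      pr = (cd I q, cc I q)) ∨
    (∃ p q, (p, q) ∈ I.R1 ∧ ∃ hq : q ∈ I.Rs, pr = (ce I p, cc I ⟨q, hq⟩)) ∨
    (∃ p q, (p, q) ∈ I.R2 ∧ ∃ hp : p ∈ I.L, pr = (ce I q, cb I ⟨p, hp⟩)) ∨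
    (∃ p q, (p, q) ∈ I.R3 ∧ ∃ hp : p ∈ I.L, ∃ hq : q ∈ I.Rs,
      pr = (ca I ⟨p, hp⟩, cc I ⟨q, hq⟩)) ∨
    (∃ p q, (p, q) ∈ I.R4 ∧ ∃ hp : p ∈ I.L, ∃ hq : q ∈ I.Rs,
      pr = (cd I ⟨q, hq⟩, cb I ⟨p, hp⟩))}

/-- The vertex set of the semi-compactor `G''`: the vertices of the D-graph,
vertices `u_v, w_v, y_v` for every non-`H` vertex `v`, and the `x`-vertices. -/
abbrev SVert (I : Inst α) : Type := DVert I ⊕ Core I ⊕ Core I ⊕ Core I ⊕ ↥(XPairs I)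

/-- A vertex of the D-graph viewed inside the semi-compactor. -/
def sg (I : Inst α) (v : DVert I) : SVert I := Sum.inl v
/-- The vertex `u_v`. -/
def su (I : Inst α) (v : Core I) : SVert I := Sum.inr (Sum.inl v)
/-- The vertex `w_v`. -/
def sw (I : Inst α) (v : Core I) : SVert I := Sum.inr (Sum.inr (Sum.inl v))
/-- The vertex `y_v`. -/
def sy (I : Inst α) (v : Core I) : SVert I := Sum.inr (Sum.inr (Sum.inr (Sum.inl v)))
/-- The vertex `x_{v,v'}`. -/
def sx (I : Inst α) (e : ↥(XPairs I)) : SVert I := Sum.inr (Sum.inr (Sum.inr (Sum.inr e)))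

/-- The (directed) list of edges of the semi-compactor `G''`. -/
def sBase (I : Inst α) : SVert I → SVert I → Prop := fun s t =>
  (∃ u v : DVert I, dBase I u v ∧ s = sg I u ∧ t = sg I v) ∨
  (∃ v : Core I,
    (s = su I v ∧ t = sg I (hv I 0)) ∨ (s = su I v ∧ t = sg I (hv I 1)) ∨
    (s = sy I v ∧ t = sg I (hv I 0)) ∨ (s = sy I v ∧ t = sg I (hv I 2)) ∨
    (s = sw I v ∧ t = sg I (hv I 2)) ∨ (s = sw I v ∧ t = sg I (hv I 3)) ∨
    (s = su I v ∧ t = sg I (Sum.inr v)) ∨ (s = su I v ∧ t = sw I v) ∨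
    (s = su I v ∧ t = sy I v) ∨ (s = sg I (Sum.inr v) ∧ t = sw I v) ∨
    (s = sw I v ∧ t = sy I v)) ∨
  (∃ v v' : Core I, v ≠ v' ∧
    ((s = su I v ∧ t = su I v') ∨ (s = sw I v ∧ t = sw I v'))) ∨
  (∃ e : ↥(XPairs I),
    (s = sx I e ∧ t = sg I (Sum.inr e.val.1)) ∨
    (s = sx I e ∧ t = sg I (Sum.inr e.val.2)) ∨
    (s = sx I e ∧ t = su I e.val.1) ∨
    (s = sx I e ∧ t = sw I e.val.2) ∨
    (s = sx I e ∧ t = sg I (hv I 0)) ∨ (s = sx I e ∧ t = sg I (hv I 2)))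

/-- The semi-compactor `G''` of the D-graph of `I`. -/
def SGraph (I : Inst α) : SimpleGraph (SVert I) := SimpleGraph.fromRel (sBase I)

/-- A retraction from the semi-compactor to `H`: a homomorphism fixing `h0,…,h3`. -/
def SRetr (I : Inst α) (g : SVert I → ZMod 4) : Prop :=
  IsHomC4 (SGraph I) g ∧ ∀ i : ZMod 4, g (sg I (hv I i)) = i

/-- A compaction from a simple graph `G` to the reflexive 4-cycle `H`:
a homomorphism such that every cycle edge of `H` is the image of an edge. -/
def IsCompactionC4 {V : Type} (G : SimpleGraph V) (f : V → ZMod 4) : Prop :=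
  IsHomC4 G f ∧ ∀ x y : ZMod 4, C4adj x y → ∃ u v : V, G.Adj u v ∧ f u = x ∧ f v = y

/-- Equality or adjacency in the 4-cycle, i.e. not being antipodal. -/
abbrev Near (x y : ZMod 4) : Prop := x ≠ y + 2

/-- `f` maps related vertices to equal or adjacent vertices of the 4-cycle. -/
def MapsNear {V : Type} (r : V → V → Prop) (f : V → ZMod 4) : Prop :=
  ∀ s t, r s t → Near (f s) (f t)

theorem near_comm {x y : ZMod 4} : Near x y ↔ Near y x := by
  revert x y; decide

theorem near_iff {x y : ZMod 4} : Near x y ↔ x = y ∨ C4adj x y := by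
  unfold C4adj; revert x y; decide

theorem isHomC4_fromRel_iff {V : Type} {r : V → V → Prop} {f : V → ZMod 4} :
    IsHomC4 (SimpleGraph.fromRel r) f ↔ MapsNear r f := by
  constructor
  · intro h s t hst
    by_cases hne : s = t
    · subst hne
      exact near_iff.2 (Or.inl rfl)
    · exact near_iff.2 (h s t ((SimpleGraph.fromRel_adj r s t).2 ⟨hne, Or.inl hst⟩))
  · intro h s t hst
    rcases ((SimpleGraph.fromRel_adj r s t).1 hst).2 with h' | h'
    · exact near_iff.1 (h s t h')
    · exact near_iff.1 (near_comm.1 (h t s h'))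

theorem MapsNear.sub_const {V : Type} {r : V → V → Prop} {f : V → ZMod 4}
    (h : MapsNear r f) (c : ZMod 4) : MapsNear r (fun s => f s - c) := by
  intro s t hst
  have key : ∀ x y c : ZMod 4, Near x y → Near (x - c) (y - c) := by decide
  exact key _ _ c (h s t hst)

theorem MapsNear.neg {V : Type} {r : V → V → Prop} {f : V → ZMod 4}
    (h : MapsNear r f) : MapsNear r (fun s => -f s) := by
  intro s t hst
  have key : ∀ x y : ZMod 4, Near x y → Near (-x) (-y) := by decide
  exact key _ _ (h s t hst)

section DGraphEdges

variable {I : Inst α} {g : DVert I → ZMod 4}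

theorem near_h (h : MapsNear (dBase I) g) (i : ZMod 4) : Near (g (hv I i)) (g (hv I (i + 1))) :=
  h _ _ (Or.inl ⟨i, rfl, rfl⟩)

theorem near_a (h : MapsNear (dBase I) g) (p : ↥I.L) :
    Near (g (av I p)) (g (ev I p)) ∧ Near (g (av I p)) (g (bv I p)) ∧
      Near (g (av I p)) (g (hv I 0)) ∧ Near (g (av I p)) (g (hv I 3)) := by
  refine ⟨?_, ?_, ?_, ?_⟩ <;> exact h _ _ (Or.inr (Or.inl ⟨p, by simp⟩))

theorem near_b (h : MapsNear (dBase I) g) (p : ↥I.L) :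
    Near (g (bv I p)) (g (ev I p)) ∧
      Near (g (bv I p)) (g (hv I 1)) ∧ Near (g (bv I p)) (g (hv I 2)) := by
  refine ⟨?_, ?_, ?_⟩ <;> exact h _ _ (Or.inr (Or.inl ⟨p, by simp⟩))

theorem near_c (h : MapsNear (dBase I) g) (q : ↥I.Rs) :
    Near (g (cv I q)) (g (ev I q)) ∧ Near (g (cv I q)) (g (dv I q)) ∧
      Near (g (cv I q)) (g (hv I 2)) ∧ Near (g (cv I q)) (g (hv I 3)) := by
  refine ⟨?_, ?_, ?_, ?_⟩ <;> exact h _ _ (Or.inr (Or.inr (Or.inl ⟨q, by simp⟩)))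

theorem near_d (h : MapsNear (dBase I) g) (q : ↥I.Rs) :
    Near (g (dv I q)) (g (ev I q)) ∧
      Near (g (dv I q)) (g (hv I 0)) ∧ Near (g (dv I q)) (g (hv I 1)) := by
  refine ⟨?_, ?_, ?_⟩ <;> exact h _ _ (Or.inr (Or.inr (Or.inl ⟨q, by simp⟩)))

theorem near_e (h : MapsNear (dBase I) g) (a : α) : Near (g (hv I 0)) (g (ev I a)) :=
  h _ _ (Or.inr (Or.inr (Or.inr (Or.inl ⟨a, rfl, rfl⟩))))

theorem near_R1 (h : MapsNear (dBase I) g) {p q : α} (hpq : (p, q) ∈ I.R1) (hq : q ∈ I.Rs) :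
    Near (g (cv I ⟨q, hq⟩)) (g (ev I p)) ∧ Near (g (ev I q)) (g (hv I 2)) := by
  constructor <;>
    exact h _ _ (Or.inr (Or.inr (Or.inr (Or.inr (Or.inl ⟨p, q, hpq, hq, by simp⟩)))))

theorem near_R2 (h : MapsNear (dBase I) g) {p q : α} (hpq : (p, q) ∈ I.R2) (hp : p ∈ I.L) :
    Near (g (ev I p)) (g (hv I 2)) ∧ Near (g (bv I ⟨p, hp⟩)) (g (ev I q)) := by
  constructor <;>
    exact h _ _ (Or.inr (Or.inr (Or.inr (Or.inr (Or.inr (Or.inl ⟨p, q, hpq, hp, by simp⟩))))))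

theorem near_R3 (h : MapsNear (dBase I) g) {p q : α} (hpq : (p, q) ∈ I.R3) (hp : p ∈ I.L)
    (hq : q ∈ I.Rs) :
    Near (g (ev I p)) (g (hv I 2)) ∧ Near (g (ev I q)) (g (hv I 2)) ∧
      Near (g (av I ⟨p, hp⟩)) (g (cv I ⟨q, hq⟩)) := by
  refine ⟨?_, ?_, ?_⟩ <;>
    exact h _ _ (Or.inr (Or.inr (Or.inr (Or.inr (Or.inr (Or.inr (Or.inl
      ⟨p, q, hpq, hp, hq, by simp⟩)))))))

theorem near_R4 (h : MapsNear (dBase I) g) {p q : α} (hpq : (p, q) ∈ I.R4) (hp : p ∈ I.L)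
    (hq : q ∈ I.Rs) :
    Near (g (ev I p)) (g (hv I 2)) ∧ Near (g (ev I q)) (g (hv I 2)) ∧
      Near (g (bv I ⟨p, hp⟩)) (g (dv I ⟨q, hq⟩)) := by
  refine ⟨?_, ?_, ?_⟩ <;>
    exact h _ _ (Or.inr (Or.inr (Or.inr (Or.inr (Or.inr (Or.inr (Or.inr (Or.inl
      ⟨p, q, hpq, hp, hq, by simp⟩))))))))

theorem near_b_b (h : MapsNear (dBase I) g) (p p' : ↥I.L) : Near (g (bv I p)) (g (bv I p')) := by
  by_cases hne : p = p'
  · subst hne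
    exact near_iff.2 (Or.inl rfl)
  · exact h _ _ (Or.inr (Or.inr (Or.inr (Or.inr (Or.inr (Or.inr (Or.inr (Or.inr (Or.inl
      ⟨p, p', hne, by simp⟩)))))))))

theorem near_c_c (h : MapsNear (dBase I) g) (q q' : ↥I.Rs) :
    Near (g (cv I q)) (g (cv I q')) := by
  by_cases hne : q = q'
  · subst hne
    exact near_iff.2 (Or.inl rfl)
  · exact h _ _ (Or.inr (Or.inr (Or.inr (Or.inr (Or.inr (Or.inr (Or.inr (Or.inr (Or.inr
      ⟨q, q', hne, by simp⟩)))))))))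

/-- The two vertices indexing an `x`-vertex are adjacent in the D-graph. -/
theorem near_of_mem_XPairs (h : MapsNear (dBase I) g) {v v' : Core I} (hv : (v, v') ∈ XPairs I) :
    Near (g (Sum.inr v)) (g (Sum.inr v')) := by
  rcases hv with ⟨p, hv | hv | hv⟩ | ⟨q, hv | hv | hv⟩ | ⟨p, q, hpq, hq, hv⟩ |
    ⟨p, q, hpq, hp, hv⟩ | ⟨p, q, hpq, hp, hq, hv⟩ | ⟨p, q, hpq, hp, hq, hv⟩ <;>
    obtain ⟨rfl, rfl⟩ := Prod.mk.inj hv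
  · exact (near_a h p).1
  · exact near_comm.1 (near_b h p).1
  · exact (near_a h p).2.1
  · exact near_comm.1 (near_c h q).1
  · exact near_comm.1 (near_d h q).1
  · exact near_comm.1 (near_c h q).2.1
  · exact near_comm.1 (near_R1 h hpq hq).1
  · exact near_comm.1 (near_R2 h hpq hp).2
  · exact (near_R3 h hpq hp hq).2.2
  · exact near_comm.1 (near_R4 h hpq hp hq).2.2

theorem exists_c_of_not_near (h : MapsNear (dBase I) g) {a : α}
    (ha : ¬ Near (g (ev I a)) (g (hv I 2))) : ∃ q, (ce I a, cc I q) ∈ XPairs I := by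
  rcases I.cover a with ⟨b, hb⟩ | ⟨b, hb⟩
  · have hp : a ∈ I.L := ⟨b, hb⟩
    have hq : b ∈ I.Rs := ⟨a, hb⟩
    rcases hb with ((hb | hb) | hb) | hb
    · exact ⟨⟨b, hq⟩, Or.inr (Or.inr (Or.inl ⟨a, b, hb, hq, rfl⟩))⟩
    · exact absurd (near_R2 h hb hp).1 ha
    · exact absurd (near_R3 h hb hp hq).1 ha
    · exact absurd (near_R4 h hb hp hq).1 ha
  · exact ⟨⟨a, b, hb⟩, Or.inr (Or.inl ⟨⟨a, b, hb⟩, Or.inl rfl⟩)⟩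

theorem exists_b_of_not_near (h : MapsNear (dBase I) g) {a : α}
    (ha : ¬ Near (g (ev I a)) (g (hv I 2))) : ∃ p, (ce I a, cb I p) ∈ XPairs I := by
  rcases I.cover a with ⟨b, hb⟩ | ⟨b, hb⟩
  · exact ⟨⟨a, b, hb⟩, Or.inl ⟨⟨a, b, hb⟩, Or.inr (Or.inl rfl)⟩⟩
  · have hp : b ∈ I.L := ⟨a, hb⟩
    have hq : a ∈ I.Rs := ⟨b, hb⟩
    rcases hb with ((hb | hb) | hb) | hb
    · exact absurd (near_R1 h hb hq).2 ha
    · exact ⟨⟨b, hp⟩, Or.inr (Or.inr (Or.inr (Or.inl ⟨b, a, hb, hp, rfl⟩)))⟩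
    · exact absurd (near_R3 h hb hp hq).2.1 ha
    · exact absurd (near_R4 h hb hp hq).2.1 ha

end DGraphEdges

section Extension

/-- The value forced at `u_v` by the value at `v` in a retraction. -/
def uVal (x : ZMod 4) : ZMod 4 := if x = 0 ∨ x = 3 then 0 else 1

/-- The value forced at `w_v` by the value at `v` in a retraction. -/
def wVal (x : ZMod 4) : ZMod 4 := if x = 0 ∨ x = 3 then 3 else 2

/-- The value forced at `y_v` by the value at `v` in a retraction. -/
def yVal (x : ZMod 4) : ZMod 4 := if x = 0 ∨ x = 3 then 3 else 1

/-- A value at `x_{v,v'}` given the values at `v` and `v'`. -/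
def xVal (x x' : ZMod 4) : ZMod 4 := if x = 1 ∨ x = 2 ∨ x' = 1 then 1 else 3

/-- The condition on the values at `v` and `v'` under which `x_{v,v'}` can be coloured. -/
abbrev XExtendable (x x' : ZMod 4) : Prop :=
  ¬ ((x = 1 ∨ x = 2) ∧ (x' = 0 ∨ x' = 3)) ∧ ¬ (x = 3 ∧ x' = 1)

variable {I : Inst α}

/-- The extension of a map on the D-graph to the semi-compactor. -/
def extendMap (g : DVert I → ZMod 4) : SVert I → ZMod 4
  | Sum.inl v => g v
  | Sum.inr (Sum.inl v) => uVal (g (Sum.inr v))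
  | Sum.inr (Sum.inr (Sum.inl v)) => wVal (g (Sum.inr v))
  | Sum.inr (Sum.inr (Sum.inr (Sum.inl v))) => yVal (g (Sum.inr v))
  | Sum.inr (Sum.inr (Sum.inr (Sum.inr e))) => xVal (g (Sum.inr e.1.1)) (g (Sum.inr e.1.2))

theorem xExtendable_of_mem_XPairs {g : DVert I → ZMod 4} (h : MapsNear (dBase I) g)
    (h0 : ∀ i, g (hv I i) = i) {v v' : Core I} (hv : (v, v') ∈ XPairs I) :
    XExtendable (g (Sum.inr v)) (g (Sum.inr v')) := by
  have hnear := near_of_mem_XPairs h hv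
  have he : ∀ a, Near 0 (g (ev I a)) := fun a => by simpa [h0] using near_e h a
  have ha : ∀ p, Near (g (av I p)) 0 ∧ Near (g (av I p)) 3 := fun p => by
    simpa [h0] using (near_a h p).2.2
  have hb : ∀ p, Near (g (bv I p)) 1 ∧ Near (g (bv I p)) 2 := fun p => by
    simpa [h0] using (near_b h p).2
  have hc : ∀ q, Near (g (cv I q)) 2 ∧ Near (g (cv I q)) 3 := fun q => by
    simpa [h0] using (near_c h q).2.2
  have hd : ∀ q, Near (g (dv I q)) 0 ∧ Near (g (dv I q)) 1 := fun q => by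
    simpa [h0] using (near_d h q).2
  have key_a : ∀ x x' : ZMod 4, Near x x' → Near x 0 ∧ Near x 3 → XExtendable x x' := by decide
  have key_b : ∀ x x' : ZMod 4, Near x x' → Near x' 1 ∧ Near x' 2 → XExtendable x x' := by decide
  have key_c : ∀ x x' : ZMod 4, Near x x' → Near 0 x → Near x' 2 ∧ Near x' 3 →
    XExtendable x x' := by decide
  have key_dc : ∀ x x' : ZMod 4, Near x x' → Near x 0 ∧ Near x 1 → Near x' 2 ∧ Near x' 3 →
    XExtendable x x' := by decide
  have key_d : ∀ x x' y : ZMod 4, Near x x' ∧ Near 0 x ∧ (Near x' 0 ∧ Near x' 1) ∧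
    (Near y x ∧ Near y x') ∧ (Near y 2 ∧ Near y 3) → XExtendable x x' := by decide
  rcases hv with ⟨p, hv | hv | hv⟩ | ⟨q, hv | hv | hv⟩ | ⟨p, q, hpq, hq, hv⟩ |
    ⟨p, q, hpq, hp, hv⟩ | ⟨p, q, hpq, hp, hq, hv⟩ | ⟨p, q, hpq, hp, hq, hv⟩ <;>
    obtain ⟨rfl, rfl⟩ := Prod.mk.inj hv
  · exact key_a _ _ hnear (ha p)
  · exact key_b _ _ hnear (hb p)
  · exact key_a _ _ hnear (ha p)
  · exact key_c _ _ hnear (he q) (hc q)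
  · exact key_d _ _ (g (cv I q)) ⟨hnear, he q, hd q, ⟨(near_c h q).1, (near_c h q).2.1⟩, hc q⟩
  · exact key_dc _ _ hnear (hd q) (hc q)
  · exact key_c _ _ hnear (he p) (hc ⟨q, hq⟩)
  · exact key_b _ _ hnear (hb ⟨p, hp⟩)
  · exact key_a _ _ hnear (ha ⟨p, hp⟩)
  · exact key_b _ _ hnear (hb ⟨p, hp⟩)

theorem mapsNear_extendMap {g : DVert I → ZMod 4} (h : MapsNear (dBase I) g)
    (h0 : ∀ i, g (hv I i) = i) : MapsNear (sBase I) (extendMap g) := by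
  have hsg : ∀ i, extendMap g (sg I (hv I i)) = i := h0
  have key : ∀ x : ZMod 4, Near (uVal x) 0 ∧ Near (uVal x) 1 ∧ Near (yVal x) 0 ∧
      Near (yVal x) 2 ∧ Near (wVal x) 2 ∧ Near (wVal x) 3 ∧ Near (uVal x) x ∧
      Near (uVal x) (wVal x) ∧ Near (uVal x) (yVal x) ∧ Near x (wVal x) ∧
      Near (wVal x) (yVal x) := by decide
  have key_clique : ∀ x x' : ZMod 4, Near (uVal x) (uVal x') ∧ Near (wVal x) (wVal x') := by
    decide
  have key_x : ∀ x x' : ZMod 4, Near x x' → XExtendable x x' → Near (xVal x x') x ∧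
      Near (xVal x x') x' ∧ Near (xVal x x') (uVal x) ∧ Near (xVal x x') (wVal x') ∧
      Near (xVal x x') 0 ∧ Near (xVal x x') 2 := by decide
  rintro s t (⟨u, v, huv, rfl, rfl⟩ | ⟨v, hst⟩ | ⟨v, v', -, hst⟩ | ⟨e, hst⟩)
  · exact h u v huv
  · obtain ⟨k1, k2, k3, k4, k5, k6, k7, k8, k9, k10, k11⟩ := key (g (Sum.inr v))
    rcases hst with ⟨rfl, rfl⟩ | ⟨rfl, rfl⟩ | ⟨rfl, rfl⟩ | ⟨rfl, rfl⟩ | ⟨rfl, rfl⟩ | ⟨rfl, rfl⟩ |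
      ⟨rfl, rfl⟩ | ⟨rfl, rfl⟩ | ⟨rfl, rfl⟩ | ⟨rfl, rfl⟩ | ⟨rfl, rfl⟩ <;>
      (try rw [hsg]) <;> assumption
  · obtain ⟨k1, k2⟩ := key_clique (g (Sum.inr v)) (g (Sum.inr v'))
    rcases hst with ⟨rfl, rfl⟩ | ⟨rfl, rfl⟩ <;> assumption
  · obtain ⟨k1, k2, k3, k4, k5, k6⟩ := key_x (g (Sum.inr e.1.1)) (g (Sum.inr e.1.2))
      (near_of_mem_XPairs h e.2) (xExtendable_of_mem_XPairs h h0 e.2)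
    rcases hst with ⟨rfl, rfl⟩ | ⟨rfl, rfl⟩ | ⟨rfl, rfl⟩ | ⟨rfl, rfl⟩ | ⟨rfl, rfl⟩ | ⟨rfl, rfl⟩ <;>
      (try rw [hsg]) <;> assumption

end Extension

section SemiCompactorEdges

variable {I : Inst α} {f : SVert I → ZMod 4}

theorem MapsNear.restrict (h : MapsNear (sBase I) f) : MapsNear (dBase I) (fun v => f (sg I v)) :=
  fun u v huv => h _ _ (Or.inl ⟨u, v, huv, rfl, rfl⟩)

theorem near_u (h : MapsNear (sBase I) f) (v : Core I) :
    Near (f (su I v)) (f (sg I (hv I 0))) ∧ Near (f (su I v)) (f (sg I (hv I 1))) ∧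
      Near (f (su I v)) (f (sg I (Sum.inr v))) ∧ Near (f (su I v)) (f (sw I v)) ∧
      Near (f (su I v)) (f (sy I v)) := by
  refine ⟨?_, ?_, ?_, ?_, ?_⟩ <;> exact h _ _ (Or.inr (Or.inl ⟨v, by simp⟩))

theorem near_w (h : MapsNear (sBase I) f) (v : Core I) :
    Near (f (sw I v)) (f (sg I (hv I 2))) ∧ Near (f (sw I v)) (f (sg I (hv I 3))) ∧
      Near (f (sg I (Sum.inr v))) (f (sw I v)) ∧ Near (f (sw I v)) (f (sy I v)) := by
  refine ⟨?_, ?_, ?_, ?_⟩ <;> exact h _ _ (Or.inr (Or.inl ⟨v, by simp⟩))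

theorem near_y (h : MapsNear (sBase I) f) (v : Core I) :
    Near (f (sy I v)) (f (sg I (hv I 0))) ∧ Near (f (sy I v)) (f (sg I (hv I 2))) := by
  constructor <;> exact h _ _ (Or.inr (Or.inl ⟨v, by simp⟩))

theorem near_u_u (h : MapsNear (sBase I) f) (v v' : Core I) :
    Near (f (su I v)) (f (su I v')) := by
  by_cases hne : v = v'
  · subst hne
    exact near_iff.2 (Or.inl rfl)
  · exact h _ _ (Or.inr (Or.inr (Or.inl ⟨v, v', hne, Or.inl ⟨rfl, rfl⟩⟩)))

theorem near_w_w (h : MapsNear (sBase I) f) (v v' : Core I) :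
    Near (f (sw I v)) (f (sw I v')) := by
  by_cases hne : v = v'
  · subst hne
    exact near_iff.2 (Or.inl rfl)
  · exact h _ _ (Or.inr (Or.inr (Or.inl ⟨v, v', hne, Or.inr ⟨rfl, rfl⟩⟩)))

theorem near_x (h : MapsNear (sBase I) f) (e : ↥(XPairs I)) :
    Near (f (sx I e)) (f (sg I (Sum.inr e.1.1))) ∧
      Near (f (sx I e)) (f (sg I (Sum.inr e.1.2))) ∧
      Near (f (sx I e)) (f (su I e.1.1)) ∧ Near (f (sx I e)) (f (sw I e.1.2)) ∧
      Near (f (sx I e)) (f (sg I (hv I 0))) ∧ Near (f (sx I e)) (f (sg I (hv I 2))) := by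
  refine ⟨?_, ?_, ?_, ?_, ?_, ?_⟩ <;> exact h _ _ (Or.inr (Or.inr (Or.inr ⟨e, by simp⟩)))

/-- The image of every vertex of the semi-compactor equals or is adjacent to the image of
`h0` or of `h2`. -/
theorem near_h0_or_near_h2 (h : MapsNear (sBase I) f) (s : SVert I) :
    Near (f s) (f (sg I (hv I 0))) ∨ Near (f s) (f (sg I (hv I 2))) := by
  have hd := h.restrict
  rcases s with (i | a | p | p | q | q) | v | v | v | e
  · have h01 : Near (f (sg I (hv I 0))) (f (sg I (hv I 1))) := near_h hd 0
    have h23 : Near (f (sg I (hv I 2))) (f (sg I (hv I 3))) := near_h hd 2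
    fin_cases i
    · exact Or.inl (near_iff.2 (Or.inl rfl))
    · exact Or.inl (near_comm.1 h01)
    · exact Or.inr (near_iff.2 (Or.inl rfl))
    · exact Or.inr (near_comm.1 h23)
  · exact Or.inl (near_comm.1 (near_e hd a))
  · exact Or.inl (near_a hd p).2.2.1
  · exact Or.inr (near_b hd p).2.2
  · exact Or.inr (near_c hd q).2.2.1
  · exact Or.inl (near_d hd q).2.1
  · exact Or.inl (near_u h v).1
  · exact Or.inr (near_w h v).1
  · exact Or.inl (near_y h v).1
  · exact Or.inl (near_x h e).2.2.2.2.1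

/-- If `h1` and `h3` are identified between `h0` and `h2`, the fourth vertex is missed. -/
theorem ne_three_of_h_eq_zero_one_two_one (h : MapsNear (sBase I) f)
    (h0 : f (sg I (hv I 0)) = 0) (h1 : f (sg I (hv I 1)) = 1) (h2 : f (sg I (hv I 2)) = 2)
    (h3 : f (sg I (hv I 3)) = 1) (s : SVert I) : f s ≠ 3 := by
  have hd := h.restrict
  have not_near : ∀ {x : ZMod 4}, Near x 1 → x ≠ 3 := by decide
  rcases s with (i | a | p | p | q | q) | v | v | v | e
  · fin_cases i
    · exact (h0.trans_ne (by decide) : f (sg I (hv I 0)) ≠ 3)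
    · exact (h1.trans_ne (by decide) : f (sg I (hv I 1)) ≠ 3)
    · exact (h2.trans_ne (by decide) : f (sg I (hv I 2)) ≠ 3)
    · exact (h3.trans_ne (by decide) : f (sg I (hv I 3)) ≠ 3)
  · have key : ∀ x u w : ZMod 4, Near u 0 → Near u 1 → Near u x → Near u w → Near w 2 →
        Near w 1 → Near x w → x ≠ 3 := by decide
    obtain ⟨k1, k2, k3, k4, -⟩ := near_u h (ce I a)
    obtain ⟨l1, l2, l3, -⟩ := near_w h (ce I a)
    rw [h0] at k1
    rw [h1] at k2
    rw [h2] at l1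
    rw [h3] at l2
    exact key _ _ _ k1 k2 k3 k4 l1 l2 l3
  · exact not_near (h3 ▸ (near_a hd p).2.2.2)
  · exact not_near (h1 ▸ (near_b hd p).2.1)
  · exact not_near (h3 ▸ (near_c hd q).2.2.2)
  · exact not_near (h1 ▸ (near_d hd q).2.2)
  · exact not_near (h1 ▸ (near_u h v).2.1)
  · exact not_near (h3 ▸ (near_w h v).2.1)
  · have key : ∀ y u w : ZMod 4, Near u 0 ∧ Near u 1 → Near w 2 ∧ Near w 1 → Near u w →
        Near u y → Near w y → y ≠ 3 := by decide
    obtain ⟨k1, k2, -, k4, k5⟩ := near_u h v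
    obtain ⟨l1, l2, -, l4⟩ := near_w h v
    rw [h0] at k1
    rw [h1] at k2
    rw [h2] at l1
    rw [h3] at l2
    exact key _ _ _ ⟨k1, k2⟩ ⟨l1, l2⟩ k4 k5 l4
  · intro hx
    have key : ∀ v u w : ZMod 4,
        (Near u 0 ∧ Near u 1) ∧ (Near w 2 ∧ Near w 1) ∧ Near u v ∧ Near u w ∧ Near v w ∧ Near 3 v →
          (Near 3 u → v = 0) ∧ (Near 3 w → v = 2) := by decide
    have gadget : ∀ v, Near 3 (f (sg I (Sum.inr v))) →
        (Near 3 (f (su I v)) → f (sg I (Sum.inr v)) = 0) ∧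
          (Near 3 (f (sw I v)) → f (sg I (Sum.inr v)) = 2) := by
      intro v hv
      obtain ⟨k1, k2, k3, k4, -⟩ := near_u h v
      obtain ⟨l1, l2, l3, -⟩ := near_w h v
      rw [h0] at k1
      rw [h1] at k2
      rw [h2] at l1
      rw [h3] at l2
      exact key _ _ _ ⟨⟨k1, k2⟩, ⟨l1, l2⟩, k3, k4, l3, hv⟩
    obtain ⟨m1, m2, m3, m4, -, -⟩ := near_x h e
    change f (sx I e) = 3 at hx
    rw [hx] at m1 m2 m3 m4
    have hnear : Near (f (sg I (Sum.inr e.1.1))) (f (sg I (Sum.inr e.1.2))) :=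
      near_of_mem_XPairs hd e.2
    rw [(gadget _ m1).1 m3, (gadget _ m2).2 m4] at hnear
    exact absurd hnear (by decide)

/-- If `h0 ↦ 0` and `h2 ↦ 1`, then the values `2` and `3` are not both attained. -/
theorem not_surjective_of_h0_eq_zero_of_h2_eq_one (h : MapsNear (sBase I) f)
    (h0 : f (sg I (hv I 0)) = 0) (h2 : f (sg I (hv I 2)) = 1) : ¬ Function.Surjective f := by
  intro hsurj
  have hd := h.restrict
  have hu : ∀ v, f (su I v) = 3 → ∀ v', f (su I v') ≠ 1 := by
    intro v hv v' hv'
    have := near_u_u h v v'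
    rw [hv, hv'] at this
    exact this (by decide)
  have hw : ∀ v, f (sw I v) = 2 → ∀ v', f (sw I v') ≠ 0 := by
    intro v hv v' hv'
    have := near_w_w h v v'
    rw [hv, hv'] at this
    exact this (by decide)
  have gadget : ∀ v, (f (sg I (Sum.inr v)) = 2 ∨ f (sw I v) = 2 → f (su I v) = 1) ∧
      (f (sg I (Sum.inr v)) = 3 ∨ f (su I v) = 3 → f (sw I v) = 0) := by
    intro v
    have key : ∀ x u w y : ZMod 4, (Near u 0 ∧ Near u x ∧ Near u w ∧ Near u y) ∧
        (Near w 1 ∧ Near x w ∧ Near w y) ∧ (Near y 0 ∧ Near y 1) →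
        (x = 2 ∨ w = 2 → u = 1) ∧ (x = 3 ∨ u = 3 → w = 0) := by decide
    obtain ⟨k1, -, k3, k4, k5⟩ := near_u h v
    obtain ⟨l1, -, l3, l4⟩ := near_w h v
    obtain ⟨m1, m2⟩ := near_y h v
    rw [h0] at k1 m1
    rw [h2] at l1 m2
    exact key _ _ _ _ ⟨⟨k1, k3, k4, k5⟩, ⟨l1, l3, l4⟩, ⟨m1, m2⟩⟩
  have hx : ∀ v v', (v, v') ∈ XPairs I → f (sg I (Sum.inr v)) = 3 →
      Near (f (sg I (Sum.inr v'))) 1 → ¬ Near (f (sg I (Sum.inr v'))) 2 := by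
    intro v v' hvv hv hv1 hv2
    have key : ∀ x z : ZMod 4, Near x 3 → Near x z → Near x 0 → Near x 1 →
        Near 3 z → Near z 1 → ¬ Near z 2 := by decide
    have hnear : Near (f (sg I (Sum.inr v))) (f (sg I (Sum.inr v'))) := near_of_mem_XPairs hd hvv
    obtain ⟨m1, m2, -, -, m5, m6⟩ := near_x h ⟨(v, v'), hvv⟩
    rw [h0] at m5
    rw [h2] at m6
    rw [hv] at m1 hnear
    exact key _ _ m1 m2 m5 m6 hnear hv1 hv2
  have near_one : ∀ x : ZMod 4, Near x 1 → x ≠ 3 := by decide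
  have near_zero : ∀ x : ZMod 4, Near x 0 → x ≠ 2 := by decide
  have key_h : ∀ x : ZMod 4, Near 0 x → Near x 1 → x = 0 ∨ x = 1 := by decide
  have hh1 : f (sg I (hv I 1)) = 0 ∨ f (sg I (hv I 1)) = 1 := by
    have h01 : Near (f (sg I (hv I 0))) (f (sg I (hv I 1))) := near_h hd 0
    have h12 : Near (f (sg I (hv I 1))) (f (sg I (hv I 2))) := near_h hd 1
    rw [h0] at h01
    rw [h2] at h12
    exact key_h _ h01 h12
  have hh3 : f (sg I (hv I 3)) = 0 ∨ f (sg I (hv I 3)) = 1 := by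
    have h23 : Near (f (sg I (hv I 2))) (f (sg I (hv I 3))) := near_h hd 2
    have h30 : Near (f (sg I (hv I 3))) (f (sg I (hv I 0))) := near_h hd 3
    rw [h0] at h30
    rw [h2] at h23
    exact key_h _ (near_comm.1 h30) (near_comm.1 h23)
  have hh : ∀ i, f (sg I (hv I i)) = 0 ∨ f (sg I (hv I i)) = 1 := by
    intro i
    fin_cases i
    exacts [Or.inl h0, hh1, Or.inr h2, hh3]
  obtain ⟨v, hvu⟩ : ∃ v, f (sg I (Sum.inr v)) = 3 ∨ f (su I v) = 3 := by
    obtain ⟨s, hs⟩ := hsurj 3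
    rcases s with (i | v) | v | v | v | e
    · have hs' : f (sg I (hv I i)) = 3 := hs
      rcases hh i with h' | h' <;> exact absurd (h'.symm.trans hs') (by decide)
    · exact ⟨v, Or.inl hs⟩
    · exact ⟨v, Or.inr hs⟩
    · exact absurd hs (near_one _ (h2 ▸ (near_w h v).1))
    · exact absurd hs (near_one _ (h2 ▸ (near_y h v).2))
    · exact absurd hs (near_one _ (h2 ▸ (near_x h e).2.2.2.2.2))
  obtain ⟨v', hv'⟩ : ∃ v, f (sg I (Sum.inr v)) = 2 ∨ f (sw I v) = 2 := by
    obtain ⟨s, hs⟩ := hsurj 2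
    rcases s with (i | v) | v | v | v | e
    · have hs' : f (sg I (hv I i)) = 2 := hs
      rcases hh i with h' | h' <;> exact absurd (h'.symm.trans hs') (by decide)
    · exact ⟨v, Or.inl hs⟩
    · exact absurd hs (near_zero _ (h0 ▸ (near_u h v).1))
    · exact ⟨v, Or.inr hs⟩
    · exact absurd hs (near_zero _ (h0 ▸ (near_y h v).1))
    · exact absurd hs (near_zero _ (h0 ▸ (near_x h e).2.2.2.2.1))
  have hv3 : f (sg I (Sum.inr v)) = 3 :=
    hvu.resolve_right fun hu3 => hu v hu3 v' ((gadget v').1 hv')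
  have hv2 : f (sg I (Sum.inr v')) = 2 :=
    hv'.resolve_right fun hw2 => hw v' hw2 v ((gadget v).2 hvu)
  have far : ∀ {a}, f (sg I (ev I a)) = 3 → ¬ Near (f (sg I (ev I a))) (f (sg I (hv I 2))) := by
    intro a ha
    rw [ha, h2]
    decide
  rcases v' with a' | p' | p' | q' | q'
  · exact absurd hv2 (near_zero _ (near_comm.1 (h0 ▸ near_e hd a')))
  · exact absurd hv2 (near_zero _ (h0 ▸ (near_a hd p').2.2.1))
  · have hb : ∀ p, Near (f (sg I (bv I p))) 1 ∧ Near (f (sg I (bv I p))) 2 := fun p =>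
      ⟨h2 ▸ (near_b hd p).2.2, hv2 ▸ near_b_b hd p p'⟩
    have h1 : f (sg I (hv I 1)) = 1 :=
      hh1.resolve_left fun h1 => near_zero _ (h1 ▸ (near_b hd p').2.1) hv2
    rcases v with a | p | p | q | q
    · obtain ⟨p, hp⟩ := exists_b_of_not_near hd (far hv3)
      exact hx _ _ hp hv3 (hb p).1 (hb p).2
    · exact hx _ (cb I p) (Or.inl ⟨p, Or.inr (Or.inr rfl)⟩) hv3 (hb p).1 (hb p).2
    · exact near_one _ (h2 ▸ (near_b hd p).2.2) hv3
    · exact near_one _ (h2 ▸ (near_c hd q).2.2.1) hv3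
    · exact near_one _ (h1 ▸ (near_d hd q).2.2) hv3
  · have hc : ∀ q, Near (f (sg I (cv I q))) 1 ∧ Near (f (sg I (cv I q))) 2 := fun q =>
      ⟨h2 ▸ (near_c hd q).2.2.1, hv2 ▸ near_c_c hd q q'⟩
    have h3 : f (sg I (hv I 3)) = 1 :=
      hh3.resolve_left fun h3 => near_zero _ (h3 ▸ (near_c hd q').2.2.2) hv2
    rcases v with a | p | p | q | q
    · obtain ⟨q, hq⟩ := exists_c_of_not_near hd (far hv3)
      exact hx _ _ hq hv3 (hc q).1 (hc q).2
    · exact near_one _ (h3 ▸ (near_a hd p).2.2.2) hv3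
    · exact near_one _ (h2 ▸ (near_b hd p).2.2) hv3
    · exact near_one _ (h2 ▸ (near_c hd q).2.2.1) hv3
    · exact hx _ (cc I q) (Or.inr (Or.inl ⟨q, Or.inr (Or.inr rfl)⟩)) hv3 (hc q).1 (hc q).2
  · exact absurd hv2 (near_zero _ (h0 ▸ (near_d hd q').2.1))

theorem sRetr_of_normalized (h : MapsNear (sBase I) f) (hsurj : Function.Surjective f)
    (h0 : f (sg I (hv I 0)) = 0)
    (h2 : f (sg I (hv I 2)) = 1 ∨ f (sg I (hv I 2)) = 2 ∧ f (sg I (hv I 1)) = 1) :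
    SRetr I f := by
  rcases h2 with h2 | ⟨h2, h1⟩
  · exact absurd hsurj (not_surjective_of_h0_eq_zero_of_h2_eq_one h h0 h2)
  · have h23 : Near (f (sg I (hv I 2))) (f (sg I (hv I 3))) := near_h h.restrict 2
    have h30 : Near (f (sg I (hv I 3))) (f (sg I (hv I 0))) := near_h h.restrict 3
    rw [h2] at h23
    rw [h0] at h30
    have key : ∀ x : ZMod 4, Near 2 x → Near x 0 → x = 1 ∨ x = 3 := by decide
    have h3 : f (sg I (hv I 3)) = 3 := (key _ h23 h30).resolve_left fun h3 =>
      let ⟨s, hs⟩ := hsurj 3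
      ne_three_of_h_eq_zero_one_two_one h h0 h1 h2 h3 s hs
    refine ⟨isHomC4_fromRel_iff.2 h, fun i => ?_⟩
    fin_cases i
    exacts [h0, h1, h2, h3]

theorem exists_sRetr_of_surjective (h : MapsNear (sBase I) f) (hsurj : Function.Surjective f) :
    ∃ g, SRetr I g := by
  wlog h0 : f (sg I (hv I 0)) = 0 generalizing f
  · exact this (h.sub_const (f (sg I (hv I 0)))) ((Equiv.subRight _).surjective.comp hsurj)
      (sub_self _)
  have h01 : Near (f (sg I (hv I 0))) (f (sg I (hv I 1))) := near_h h.restrict 0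
  have h12 : Near (f (sg I (hv I 1))) (f (sg I (hv I 2))) := near_h h.restrict 1
  rw [h0] at h01
  have key : ∀ x y : ZMod 4, Near 0 x → Near x y →
      y = 0 ∨ (y = 1 ∨ y = 2 ∧ x = 1) ∨ (-y = 1 ∨ -y = 2 ∧ -x = 1) := by decide
  rcases key _ _ h01 h12 with h2 | h2 | h2
  · obtain ⟨s, hs⟩ := hsurj 2
    have hnear := near_h0_or_near_h2 h s
    rw [hs, h0, h2] at hnear
    exact absurd hnear (by decide)
  · exact ⟨f, sRetr_of_normalized h hsurj h0 h2⟩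
  · exact ⟨_, sRetr_of_normalized h.neg (neg_surjective.comp hsurj) (by rw [h0, neg_zero]) h2⟩

end SemiCompactorEdges

/-- For any instance with D-graph `G` and semi-compactor `G''`, the following
are equivalent: (i) `G` retracts to the reflexive 4-cycle `H`; (ii) `G''`
retracts to `H`; (iii) `G''` compacts to `H`; (iv) `G''` admits a
vertex-surjective homomorphism to `H`. -/
theorem stmt12 (α : Type) [Fintype α] (I : Inst α) :
    List.TFAE
      [∃ g : DVert I → ZMod 4, DRetr I g,
       ∃ g : SVert I → ZMod 4, SRetr I g,
       ∃ f : SVert I → ZMod 4, IsCompactionC4 (SGraph I) f,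
       ∃ f : SVert I → ZMod 4, IsHomC4 (SGraph I) f ∧ Function.Surjective f] := by
  tfae_have 1 → 2 := fun ⟨g, hg, h0⟩ =>
    ⟨extendMap g, isHomC4_fromRel_iff.2 (mapsNear_extendMap (isHomC4_fromRel_iff.1 hg) h0), h0⟩
  tfae_have 2 → 1 := fun ⟨g, hg, h0⟩ =>
    ⟨fun v => g (sg I v), isHomC4_fromRel_iff.2 (isHomC4_fromRel_iff.1 hg).restrict, h0⟩
  tfae_have 2 → 3 := by
    rintro ⟨g, hg, h0⟩
    have hne_succ : ∀ i : ZMod 4, i ≠ i + 1 := by decide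
    have hadj : ∀ i : ZMod 4, (SGraph I).Adj (sg I (hv I i)) (sg I (hv I (i + 1))) := fun i =>
      (SimpleGraph.fromRel_adj _ _ _).2 ⟨fun hne => hne_succ i (Sum.inl.inj (Sum.inl.inj hne)),
        Or.inl (Or.inl ⟨_, _, Or.inl ⟨i, rfl, rfl⟩, rfl, rfl⟩)⟩
    refine ⟨g, hg, ?_⟩
    rintro x y (rfl | rfl)
    · exact ⟨_, _, hadj x, h0 _, h0 _⟩
    · exact ⟨_, _, (hadj y).symm, h0 _, h0 _⟩
  tfae_have 3 → 4 := fun ⟨f, hf, hedge⟩ =>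
    ⟨f, hf, fun x => let ⟨u, _, _, hu, _⟩ := hedge x (x + 1) (Or.inl rfl); ⟨u, hu⟩⟩
  tfae_have 4 → 2 := fun ⟨_, hf, hsurj⟩ =>
    exists_sRetr_of_surjective (isHomC4_fromRel_iff.1 hf) hsurj
  tfae_finish
end Paper
end

section
/- Let G be a finite connected simple graph. Then G has a disconnected cut if and only if G has a 2S2-partition. -/
namespace Paper

/-- `G` has a disconnected cut: a set `U` of vertices such that both the
subgraph induced by `U` and the one induced by its complement have at least
two connected components (i.e. contain an unreachable pair of vertices). -/
def HasDisconnectedCut {V : Type} (G : SimpleGraph V) : Prop :=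
  ∃ U : Set V,
    (∃ x y : ↥U, ¬ (G.induce U).Reachable x y) ∧
    (∃ x y : ↥(Uᶜ), ¬ (G.induce (Uᶜ)).Reachable x y)

/-- A `2S2`-partition of `G`, encoded by the map sending each vertex to the
index of its block: all four blocks are nonempty, there are no edges between
blocks 0 and 2, and none between blocks 1 and 3. -/
def TwoS2Partition {V : Type} (G : SimpleGraph V) : Prop :=
  ∃ f : V → Fin 4, Function.Surjective f ∧
    (∀ u v : V, f u = 0 → f v = 2 → ¬ G.Adj u v) ∧
    (∀ u v : V, f u = 1 → f v = 3 → ¬ G.Adj u v)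

/-- A `2K2`-partition of `G`, encoded by the map sending each vertex to the
index of its block: all four blocks are nonempty, every vertex of block 0 is
adjacent to every vertex of block 2, and likewise for blocks 1 and 3. -/
def TwoK2Partition {V : Type} (G : SimpleGraph V) : Prop :=
  ∃ f : V → Fin 4, Function.Surjective f ∧
    (∀ u v : V, f u = 0 → f v = 2 → G.Adj u v) ∧
    (∀ u v : V, f u = 1 → f v = 3 → G.Adj u v)

/-- `G` is contractible to `H`: the vertices of `G` can be partitioned into
nonempty connected witness sets `P x`, one for each vertex `x` of `H`, such
that two distinct witness sets are joined by an edge of `G` exactly when the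
corresponding vertices are adjacent in `H`. -/
def ContractsTo {V W : Type} (G : SimpleGraph V) (H : SimpleGraph W) : Prop :=
  ∃ P : W → Set V,
    (∀ x : W, (G.induce (P x)).Connected) ∧
    (∀ v : V, ∃! x : W, v ∈ P x) ∧
    (∀ x y : W, x ≠ y →
      ((∃ u ∈ P x, ∃ v ∈ P y, G.Adj u v) ↔ H.Adj x y))

/-- The subgraph induced by `U` is disconnected iff a proper nonempty part `A` of `U` sends no edge
to the rest of `U`. -/
theorem exists_not_reachable_induce_iff {V : Type*} (G : SimpleGraph V) (U : Set V) :
    (∃ x y : U, ¬ (G.induce U).Reachable x y) ↔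
      ∃ A : Set V, (U ∩ A).Nonempty ∧ (U \ A).Nonempty ∧
        ∀ u ∈ U ∩ A, ∀ v ∈ U \ A, ¬ G.Adj u v := by
  constructor
  · rintro ⟨x, y, hxy⟩
    refine ⟨{v | ∃ h : v ∈ U, (G.induce U).Reachable x ⟨v, h⟩},
      ⟨x, x.2, x.2, .refl _⟩, ⟨y, y.2, fun ⟨_, h⟩ => hxy h⟩, ?_⟩
    rintro u ⟨hu, _, hxu⟩ v ⟨hv, hxv⟩ huv
    have h : (G.induce U).Adj ⟨u, hu⟩ ⟨v, hv⟩ := huv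
    exact hxv ⟨hv, hxu.trans h.reachable⟩
  · rintro ⟨A, ⟨x, hxU, hxA⟩, ⟨y, hyU, hyA⟩, hA⟩
    refine ⟨⟨x, hxU⟩, ⟨y, hyU⟩, fun ⟨p⟩ => ?_⟩
    have walk_mem : ∀ {a b : U}, (G.induce U).Walk a b → (a : V) ∈ A → (b : V) ∈ A := by
      intro a b p
      induction p with
      | nil => exact id
      | @cons a b c hab _ ih =>
        intro ha
        exact ih (by_contra fun hb => hA a ⟨a.2, ha⟩ b ⟨b.2, hb⟩ hab)
    exact hyA (walk_mem p hxA)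

/-- A finite connected simple graph has a disconnected cut iff it has a
`2S2`-partition. -/
theorem stmt13 {V : Type} [Fintype V] (G : SimpleGraph V) (hc : G.Connected) :
    HasDisconnectedCut G ↔ TwoS2Partition G := by
  classical
  simp only [HasDisconnectedCut, exists_not_reachable_induce_iff]
  constructor
  · rintro ⟨U, ⟨A, ⟨a, haU, haA⟩, ⟨c, hcU, hcA⟩, hA⟩, B, ⟨b, hbU, hbB⟩, ⟨d, hdU, hdB⟩, hB⟩
    rw [Set.mem_compl_iff] at hbU hdU
    refine ⟨fun v => if v ∈ U then (if v ∈ A then 0 else 2) else (if v ∈ B then 1 else 3),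
      ?_, ?_, ?_⟩
    · intro i
      fin_cases i
      · exact ⟨a, by simp [haU, haA]⟩
      · exact ⟨b, by simp [hbU, hbB]⟩
      · exact ⟨c, by simp [hcU, hcA]⟩
      · exact ⟨d, by simp [hdU, hdB]⟩
    · intro u v hu hv
      refine hA u ?_ v ?_
      · dsimp only at hu
        split_ifs at hu with h1 h2 h2 <;> first | exact ⟨h1, h2⟩ | simp at hu
      · dsimp only at hv
        split_ifs at hv with h1 h2 h2 <;> first | exact ⟨h1, h2⟩ | simp at hv
    · intro u v hu hv
      refine hB u ?_ v ?_
      · dsimp only at hu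
        split_ifs at hu with h1 h2 h2 <;> first | exact ⟨h1, h2⟩ | simp at hu
      · dsimp only at hv
        split_ifs at hv with h1 h2 h2 <;> first | exact ⟨h1, h2⟩ | simp at hv
  · rintro ⟨f, hf, h02, h13⟩
    obtain ⟨a, ha⟩ := hf 0
    obtain ⟨b, hb⟩ := hf 1
    obtain ⟨c, hc⟩ := hf 2
    obtain ⟨d, hd⟩ := hf 3
    refine ⟨{v | f v = 0 ∨ f v = 2}, ⟨{v | f v = 0}, ⟨a, by simp [ha]⟩, ⟨c, by simp [hc]⟩, ?_⟩,
      {v | f v = 1}, ⟨b, by simp [hb]⟩, ⟨d, by simp [hd]⟩, ?_⟩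
    · rintro u ⟨_, hu⟩ v ⟨hv | hv, hv'⟩
      · exact absurd hv hv'
      · exact h02 u v hu hv
    · rintro u ⟨_, hu⟩ v ⟨hv, hv'⟩
      refine h13 u v hu ?_
      simp only [Set.mem_compl_iff, Set.mem_ofPred_eq] at hv hv'
      generalize f v = i at hv hv'
      revert i
      decide

end Paper
end

section
/- Let G be a finite connected simple graph. Then G has a disconnected cut if and only if G admits a vertex-surjective homomorphism to the reflexive 4-cycle H. -/
namespace Paper

/-- Two vertices of `U` are in different components of `G.induce U` as soon as some predicate
that is invariant under adjacency inside `U` separates them. -/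
theorem not_reachable_induce_of_separated {V : Type} (G : SimpleGraph V) (U : Set V)
    (p : V → Prop) (hp : ∀ u ∈ U, ∀ v ∈ U, G.Adj u v → p u → p v)
    (x y : U) (hx : p x) (hy : ¬ p y) : ¬ (G.induce U).Reachable x y := by
  rintro ⟨w⟩
  induction w with
  | nil => exact hy hx
  | @cons a b c h w ih => exact ih (hp a a.2 b b.2 h hx) hy

/-- Disconnectedness of `G.induce U` yields a separating predicate on `V`. -/
theorem exists_separated_of_not_reachable_induce {V : Type} (G : SimpleGraph V) (U : Set V)
    (x y : U) (h : ¬ (G.induce U).Reachable x y) :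
    ∃ p : V → Prop, (∀ u ∈ U, ∀ v ∈ U, G.Adj u v → (p u ↔ p v)) ∧ p x ∧ ¬ p y := by
  refine ⟨fun v => ∃ hv : v ∈ U, (G.induce U).Reachable x ⟨v, hv⟩, ?_, ⟨x.2, .rfl⟩, ?_⟩
  · intro u hu v hv huv
    have huv' : (G.induce U).Adj ⟨u, hu⟩ ⟨v, hv⟩ := huv
    exact ⟨fun ⟨_, hr⟩ => ⟨hv, hr.trans huv'.reachable⟩,
      fun ⟨_, hr⟩ => ⟨hu, hr.trans huv'.symm.reachable⟩⟩
  · exact fun ⟨_, hr⟩ => h hr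

/-- A finite connected simple graph has a disconnected cut iff it admits a
vertex-surjective homomorphism to the reflexive 4-cycle `H`. -/
theorem stmt14 {V : Type} [Fintype V] (G : SimpleGraph V) (hc : G.Connected) :
    HasDisconnectedCut G ↔
      ∃ f : V → ZMod 4, IsHomC4 G f ∧ Function.Surjective f := by
  classical
  constructor
  · rintro ⟨U, ⟨x, y, hxy⟩, z, w, hzw⟩
    obtain ⟨p, hp, hpx, hpy⟩ := exists_separated_of_not_reachable_induce G U x y hxy
    obtain ⟨q, hq, hqz, hqw⟩ := exists_separated_of_not_reachable_induce G Uᶜ z w hzw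
    refine ⟨fun v => if v ∈ U then (if p v then 0 else 2) else (if q v then 1 else 3), ?_, ?_⟩
    · intro u v huv
      by_cases hu : u ∈ U <;> by_cases hv : v ∈ U
      · simp [hu, hv, hp u hu v hv huv]
      · by_cases p u <;> by_cases q v <;> simp [C4adj, *] <;> decide
      · by_cases q u <;> by_cases p v <;> simp [C4adj, *] <;> decide
      · simp [hu, hv, hq u hu v hv huv]
    · have hz : (z : V) ∉ U := z.2
      have hw : (w : V) ∉ U := w.2
      intro i
      fin_cases i
      · exact ⟨x, by simp [hpx]; rfl⟩
      · exact ⟨z, by simp [hz, hqz]; rfl⟩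
      · exact ⟨y, by simp [hpy]; rfl⟩
      · exact ⟨w, by simp [hw, hqw]; rfl⟩
  · rintro ⟨f, hf, hs⟩
    obtain ⟨a, ha⟩ := hs 0
    obtain ⟨b, hb⟩ := hs 1
    obtain ⟨c, hc⟩ := hs 2
    obtain ⟨d, hd⟩ := hs 3
    have even_case : ∀ i j : ZMod 4, (i = 0 ∨ i = 2) → (j = 0 ∨ j = 2) →
        (i = j ∨ (j = i + 1 ∨ i = j + 1)) → i = 0 → j = 0 := by decide
    have odd_case : ∀ i j : ZMod 4, ¬ (i = 0 ∨ i = 2) → ¬ (j = 0 ∨ j = 2) →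
        (i = j ∨ (j = i + 1 ∨ i = j + 1)) → i = 1 → j = 1 := by decide
    refine ⟨{v | f v = 0 ∨ f v = 2}, ⟨⟨a, Or.inl ha⟩, ⟨c, Or.inr hc⟩, ?_⟩,
      ⟨b, ?_⟩, ⟨d, ?_⟩, ?_⟩
    · refine not_reachable_induce_of_separated G _ (fun v => f v = 0)
        (fun u hu v hv huv => even_case _ _ hu hv (hf u v huv)) _ _ ha ?_
      simp only [hc]; decide
    · simp only [Set.mem_compl_iff, Set.mem_ofPred_eq, hb]; decide
    · simp only [Set.mem_compl_iff, Set.mem_ofPred_eq, hd]; decide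
    · refine not_reachable_induce_of_separated G _ (fun v => f v = 1)
        (fun u hu v hv huv => odd_case _ _ hu hv (hf u v huv)) _ _ hb ?_
      simp only [hd]; decide

end Paper
end

section
/- Let G be a finite connected simple graph of diameter exactly 2. Then G has a disconnected cut if and only if G admits a compaction to the reflexive 4-cycle H. -/
namespace Paper

instance : DecidableRel C4adj := fun x y => inferInstanceAs (Decidable (y = x + 1 ∨ x = y + 1))

/-- In `H`, a vertex that is equal or adjacent to both ends of a cycle edge is one of the ends. -/
lemma eq_or_eq_of_C4adj : ∀ x y z : ZMod 4, C4adj x y → (x = z ∨ C4adj x z) →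
    (y = z ∨ C4adj y z) → z = x ∨ z = y := by
  decide

/-- In a graph of diameter at most 2, every surjective homomorphism to `H` is a compaction. -/
lemma IsHomC4.isCompactionC4 {V : Type} {G : SimpleGraph V} {f : V → ZMod 4}
    (hf : IsHomC4 G f) (hsurj : Function.Surjective f)
    (hdiam : ∀ u v : V, u ≠ v → ¬ G.Adj u v → ∃ w : V, G.Adj u w ∧ G.Adj v w) :
    IsCompactionC4 G f := by
  refine ⟨hf, fun x y hxy => ?_⟩
  obtain ⟨u, rfl⟩ := hsurj x
  obtain ⟨v, rfl⟩ := hsurj y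
  by_cases huv : G.Adj u v
  · exact ⟨u, v, huv, rfl, rfl⟩
  have hne : u ≠ v := by
    rintro rfl
    revert hxy
    generalize f u = a
    revert a
    decide
  obtain ⟨w, huw, hvw⟩ := hdiam u v hne huv
  rcases eq_or_eq_of_C4adj _ _ _ hxy (hf u w huw) (hf v w hvw) with h | h
  · exact ⟨w, v, hvw.symm, h, rfl⟩
  · exact ⟨u, w, huw, rfl, h⟩

/-- A function that is constant along edges is constant on connected components. -/
lemma eq_of_reachable {V α : Type} {G : SimpleGraph V} {f : V → α}
    (hf : ∀ u v, G.Adj u v → f u = f v) {u v : V} (h : G.Reachable u v) : f u = f v := by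
  obtain ⟨p⟩ := h
  induction p with
  | nil => rfl
  | cons h _ ih => exact (hf _ _ h).trans ih

lemma IsHomC4.exists_not_reachable {V : Type} {G : SimpleGraph V} {f : V → ZMod 4}
    (hf : IsHomC4 G f) (hsurj : Function.Surjective f) (a : ZMod 4) {U : Set V}
    (hU : ∀ v, v ∈ U ↔ f v = a ∨ f v = a + 2) :
    ∃ x y : U, ¬ (G.induce U).Reachable x y := by
  obtain ⟨x, hx⟩ := hsurj a
  obtain ⟨y, hy⟩ := hsurj (a + 2)
  refine ⟨⟨x, (hU x).2 (.inl hx)⟩, ⟨y, (hU y).2 (.inr hy)⟩, fun h => ?_⟩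
  have key : ∀ a b c : ZMod 4, (b = a ∨ b = a + 2) → (c = a ∨ c = a + 2) →
      (b = c ∨ C4adj b c) → b = c := by decide
  have hxy : f x = f y := eq_of_reachable (f := fun v : U => f v)
    (fun u v huv => key a _ _ ((hU u).1 u.2) ((hU v).1 v.2) (hf u v huv)) h
  rw [hx, hy] at hxy
  exact (by decide : ∀ a : ZMod 4, a ≠ a + 2) a hxy

lemma HasDisconnectedCut.exists_isHomC4 {V : Type} {G : SimpleGraph V}
    (h : HasDisconnectedCut G) : ∃ f : V → ZMod 4, IsHomC4 G f ∧ Function.Surjective f := by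
  classical
  obtain ⟨U, ⟨x, y, hxy⟩, z, w, hzw⟩ := h
  let f : V → ZMod 4 := fun v =>
    if hv : v ∈ U then if (G.induce U).Reachable x ⟨v, hv⟩ then 0 else 2
    else if (G.induce Uᶜ).Reachable z ⟨v, hv⟩ then 1 else 3
  have hfU (v : V) (hv : v ∈ U) :
      f v = if (G.induce U).Reachable x ⟨v, hv⟩ then 0 else 2 := dif_pos hv
  have hfUc (v : V) (hv : v ∉ U) :
      f v = if (G.induce Uᶜ).Reachable z ⟨v, hv⟩ then 1 else 3 := dif_neg hv
  refine ⟨f, fun u v huv => ?_, fun a => ?_⟩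
  · by_cases hu : u ∈ U <;> by_cases hv : v ∈ U
    · have hadj : (G.induce U).Adj ⟨u, hu⟩ ⟨v, hv⟩ := huv
      have hiff : (G.induce U).Reachable x ⟨u, hu⟩ ↔ (G.induce U).Reachable x ⟨v, hv⟩ :=
        ⟨fun h => h.trans hadj.reachable, fun h => h.trans hadj.symm.reachable⟩
      left
      rw [hfU u hu, hfU v hv]
      simp only [hiff]
    · right
      rw [hfU u hu, hfUc v hv]
      split_ifs <;> decide
    · right
      rw [hfUc u hu, hfU v hv]
      split_ifs <;> decide
    · have hadj : (G.induce Uᶜ).Adj ⟨u, hu⟩ ⟨v, hv⟩ := huv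
      have hiff : (G.induce Uᶜ).Reachable z ⟨u, hu⟩ ↔ (G.induce Uᶜ).Reachable z ⟨v, hv⟩ :=
        ⟨fun h => h.trans hadj.reachable, fun h => h.trans hadj.symm.reachable⟩
      left
      rw [hfUc u hu, hfUc v hv]
      simp only [hiff]
  · have hcases : ∀ a : ZMod 4, a = 0 ∨ a = 1 ∨ a = 2 ∨ a = 3 := by decide
    rcases hcases a with rfl | rfl | rfl | rfl
    · exact ⟨x, (hfU x x.2).trans (if_pos (.refl _))⟩
    · exact ⟨z, (hfUc z z.2).trans (if_pos (.refl _))⟩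
    · exact ⟨y, (hfU y y.2).trans (if_neg hxy)⟩
    · exact ⟨w, (hfUc w w.2).trans (if_neg hzw)⟩

lemma IsCompactionC4.surjective {V : Type} {G : SimpleGraph V} {f : V → ZMod 4}
    (hf : IsCompactionC4 G f) : Function.Surjective f := fun a =>
  let ⟨u, _, _, hu, _⟩ := hf.2 a (a + 1) (.inl rfl)
  ⟨u, hu⟩

lemma IsCompactionC4.hasDisconnectedCut {V : Type} {G : SimpleGraph V} {f : V → ZMod 4}
    (hf : IsCompactionC4 G f) : HasDisconnectedCut G := by
  refine ⟨{v | f v = 0 ∨ f v = 0 + 2},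
    hf.1.exists_not_reachable hf.surjective 0 fun _ => Iff.rfl,
    hf.1.exists_not_reachable hf.surjective 1 fun v => ?_⟩
  have key : ∀ b : ZMod 4, ¬ (b = 0 ∨ b = 0 + 2) ↔ b = 1 ∨ b = 1 + 2 := by decide
  exact key (f v)

/-- A finite connected simple graph of diameter exactly 2 (it is not complete
and any two distinct non-adjacent vertices have a common neighbour) has a
disconnected cut iff it admits a compaction to the reflexive 4-cycle `H`. -/
theorem stmt16 {V : Type} [Fintype V] (G : SimpleGraph V) (hc : G.Connected)
    (hnotcomplete : ¬ ∀ u v : V, u ≠ v → G.Adj u v)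
    (hdiam2 : ∀ u v : V, u ≠ v → ¬ G.Adj u v →
      ∃ w : V, G.Adj u w ∧ G.Adj v w) :
    HasDisconnectedCut G ↔ ∃ f : V → ZMod 4, IsCompactionC4 G f := by
  refine ⟨fun h => ?_, fun ⟨_, hf⟩ => hf.hasDisconnectedCut⟩
  obtain ⟨f, hf, hsurj⟩ := h.exists_isHomC4
  exact ⟨f, hf.isCompactionC4 hsurj hdiam2⟩

end Paper
end

section
/- Let G be a finite connected simple graph of diameter exactly 2. Then G has a disconnected cut if and only if G is contractible to the complete bipartite graph K_{k,l} for some integers k≥2 and l≥2. -/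
namespace Paper

/-- The vertices of a connected component of an induced subgraph induce a connected graph. -/
theorem connected_induce_image_supp {V : Type} (G : SimpleGraph V) (U : Set V)
    (c : (G.induce U).ConnectedComponent) :
    (G.induce (Subtype.val '' c.supp)).Connected := by
  have h : ((G.induce U).induce c.supp).Connected := c.connected_toSimpleGraph
  let f : (G.induce U).induce c.supp →g G.induce (Subtype.val '' c.supp) :=
    { toFun := fun x => ⟨x.1.1, x.1, x.2, rfl⟩
      map_rel' := fun {_ _} hab => hab }
  refine h.map f ?_
  rintro ⟨_, x, hx, rfl⟩
  exact ⟨⟨x, hx⟩, rfl⟩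

/-- Adjacent vertices of `U` lie in the same connected component of the graph induced by `U`. -/
theorem component_eq_of_adj {V : Type} {G : SimpleGraph V} {U : Set V} {u v : V}
    (hu : u ∈ U) (hv : v ∈ U) (h : G.Adj u v) :
    (G.induce U).connectedComponentMk ⟨u, hu⟩ = (G.induce U).connectedComponentMk ⟨v, hv⟩ :=
  SimpleGraph.ConnectedComponent.eq.2 (SimpleGraph.Adj.reachable (G := G.induce U) h)

/-- In a graph where nonadjacent vertices have a common neighbour, every component of `G[U]` is
joined by an edge to every component of `G[Uᶜ]`. -/
theorem exists_adj_of_components {V : Type} {G : SimpleGraph V}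
    (hdiam2 : ∀ u v : V, u ≠ v → ¬ G.Adj u v → ∃ w : V, G.Adj u w ∧ G.Adj v w)
    (U : Set V) (c : (G.induce U).ConnectedComponent) (d : (G.induce Uᶜ).ConnectedComponent) :
    ∃ u ∈ Subtype.val '' c.supp, ∃ v ∈ Subtype.val '' d.supp, G.Adj u v := by
  induction c using SimpleGraph.ConnectedComponent.ind with | _ x
  induction d using SimpleGraph.ConnectedComponent.ind with | _ y
  obtain ⟨x, hx⟩ := x
  obtain ⟨y, hy⟩ := y
  by_cases hxy : G.Adj x y
  · exact ⟨x, ⟨_, rfl, rfl⟩, y, ⟨_, rfl, rfl⟩, hxy⟩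
  obtain ⟨w, hxw, hyw⟩ := hdiam2 x y (fun h => hy (h ▸ hx)) hxy
  by_cases hw : w ∈ U
  · exact ⟨w, ⟨⟨w, hw⟩, (component_eq_of_adj hx hw hxw).symm, rfl⟩, y, ⟨_, rfl, rfl⟩, hyw.symm⟩
  · exact ⟨x, ⟨_, rfl, rfl⟩, w, ⟨⟨w, hw⟩, (component_eq_of_adj hy hw hyw).symm, rfl⟩, hxw⟩

/-- Distinct components of an induced subgraph are not joined by an edge. -/
theorem not_adj_of_components_ne {V : Type} {G : SimpleGraph V} {U : Set V}
    {c d : (G.induce U).ConnectedComponent} (hcd : c ≠ d) :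
    ¬ ∃ u ∈ Subtype.val '' c.supp, ∃ v ∈ Subtype.val '' d.supp, G.Adj u v := by
  rintro ⟨_, ⟨⟨u, hu⟩, rfl, rfl⟩, _, ⟨⟨v, hv⟩, rfl, rfl⟩, h⟩
  exact hcd (component_eq_of_adj hu hv h)

/-- In a graph where nonadjacent vertices have a common neighbour, contracting the components of
`G[U]` and of `G[Uᶜ]` yields a complete bipartite graph. -/
theorem contractsTo_completeBipartiteGraph_of_equiv {V A B : Type} {G : SimpleGraph V}
    (hdiam2 : ∀ u v : V, u ≠ v → ¬ G.Adj u v → ∃ w : V, G.Adj u w ∧ G.Adj v w)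
    (U : Set V) (e : A ≃ (G.induce U).ConnectedComponent)
    (e' : B ≃ (G.induce Uᶜ).ConnectedComponent) :
    ContractsTo G (completeBipartiteGraph A B) := by
  refine ⟨Sum.elim (fun i => Subtype.val '' (e i).supp) (fun j => Subtype.val '' (e' j).supp),
    ?_, ?_, ?_⟩
  · rintro (i | j)
    · exact connected_induce_image_supp G U (e i)
    · exact connected_induce_image_supp G Uᶜ (e' j)
  · intro v
    by_cases hv : v ∈ U
    · refine ⟨Sum.inl (e.symm ((G.induce U).connectedComponentMk ⟨v, hv⟩)),
        ⟨⟨v, hv⟩, by simp, rfl⟩, ?_⟩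
      rintro (i | j) ⟨⟨w, hw⟩, hwc, rfl⟩
      · exact congrArg Sum.inl (e.eq_symm_apply.2 (Eq.symm hwc))
      · exact absurd hv hw
    · refine ⟨Sum.inr (e'.symm ((G.induce Uᶜ).connectedComponentMk ⟨v, hv⟩)),
        ⟨⟨v, hv⟩, by simp, rfl⟩, ?_⟩
      rintro (i | j) ⟨⟨w, hw⟩, hwc, rfl⟩
      · exact absurd hw hv
      · exact congrArg Sum.inr (e'.eq_symm_apply.2 (Eq.symm hwc))
  · rintro (i | j) (i' | j') hne
    · refine iff_of_false (not_adj_of_components_ne fun h => hne ?_) (by simp)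
      rw [e.injective h]
    · exact iff_of_true (exists_adj_of_components hdiam2 U _ _) (by simp)
    · obtain ⟨u, hu, v, hv, h⟩ := exists_adj_of_components hdiam2 U (e i') (e' j)
      exact iff_of_true ⟨v, hv, u, hu, h.symm⟩ (by simp)
    · refine iff_of_false (not_adj_of_components_ne fun h => hne ?_) (by simp)
      rw [e'.injective h]

/-- A graph with an unreachable pair of vertices has at least two connected components. -/
theorem two_le_card_connectedComponent {V : Type} [Finite V] {G : SimpleGraph V}
    (h : ∃ x y : V, ¬ G.Reachable x y) : 2 ≤ Nat.card G.ConnectedComponent := by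
  obtain ⟨x, y, hxy⟩ := h
  have : Nontrivial G.ConnectedComponent :=
    ⟨_, _, fun h => hxy (SimpleGraph.ConnectedComponent.eq.1 h)⟩
  exact Finite.one_lt_card

/-- If `f` is constant along the edges of `G[U]`, vertices of `U` with different values of `f` are
not reachable from each other in `G[U]`. -/
theorem not_reachable_induce_of_adj_imp {V W : Type} {G : SimpleGraph V} {U : Set V} (f : V → W)
    (hf : ∀ u ∈ U, ∀ v ∈ U, G.Adj u v → f u = f v) {x y : U} (hxy : f x ≠ f y) :
    ¬ (G.induce U).Reachable x y := by
  rintro ⟨p⟩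
  refine hxy ?_
  clear hxy
  induction p with
  | nil => rfl
  | cons h _ ih => exact (hf _ (Subtype.prop _) _ (Subtype.prop _) h).trans ih

/-- A graph contractible to a complete bipartite graph with both sides nontrivial has a disconnected
cut. -/
theorem hasDisconnectedCut_of_contractsTo {V A B : Type} [Nontrivial A] [Nontrivial B]
    {G : SimpleGraph V} (h : ContractsTo G (completeBipartiteGraph A B)) :
    HasDisconnectedCut G := by
  obtain ⟨P, hconn, huniq, hadj⟩ := h
  choose f hf hf' using huniq
  have hfP : ∀ {v x}, v ∈ P x → f v = x := fun {v x} hv => (hf' v x hv).symm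
  have hsurj : Function.Surjective f := fun x =>
    let ⟨v⟩ := (hconn x).nonempty
    ⟨v.1, hfP v.2⟩
  have hside : ∀ u v, G.Adj u v → (f u).isLeft = (f v).isLeft → f u = f v := by
    intro u v huv hs
    by_contra hne
    have := (hadj _ _ hne).1 ⟨u, hf u, v, hf v, huv⟩
    rcases hu : f u with a | b <;> rcases hv : f v with a' | b' <;> simp_all
  obtain ⟨a, a', ha⟩ := exists_pair_ne A
  obtain ⟨b, b', hb⟩ := exists_pair_ne B
  obtain ⟨x, hx⟩ := hsurj (Sum.inl a)
  obtain ⟨x', hx'⟩ := hsurj (Sum.inl a')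
  obtain ⟨y, hy⟩ := hsurj (Sum.inr b)
  obtain ⟨y', hy'⟩ := hsurj (Sum.inr b')
  refine ⟨{v | (f v).isLeft = true}, ⟨⟨x, by simp [hx]⟩, ⟨x', by simp [hx']⟩, ?_⟩,
    ⟨⟨y, by simp [hy]⟩, ⟨y', by simp [hy']⟩, ?_⟩⟩
  · refine not_reachable_induce_of_adj_imp f
      (fun u hu v hv h => hside u v h ?_) (by simp [hx, hx', ha])
    exact Eq.trans hu (Eq.symm hv)
  · refine not_reachable_induce_of_adj_imp f
      (fun u hu v hv h => hside u v h ?_) (by simp [hy, hy', hb])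
    exact (Bool.eq_false_of_not_eq_true hu).trans (Bool.eq_false_of_not_eq_true hv).symm

/-- A finite connected simple graph of diameter exactly 2 (it is not complete
and any two distinct non-adjacent vertices have a common neighbour) has a
disconnected cut iff it is contractible to a complete bipartite graph
`K_{k,l}` with `k, l ≥ 2`. -/
theorem stmt17 {V : Type} [Fintype V] (G : SimpleGraph V) (hc : G.Connected)
    (hnotcomplete : ¬ ∀ u v : V, u ≠ v → G.Adj u v)
    (hdiam2 : ∀ u v : V, u ≠ v → ¬ G.Adj u v →
      ∃ w : V, G.Adj u w ∧ G.Adj v w) :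
    HasDisconnectedCut G ↔
      ∃ k l : ℕ, 2 ≤ k ∧ 2 ≤ l ∧
        ContractsTo G (completeBipartiteGraph (Fin k) (Fin l)) := by
  constructor
  · rintro ⟨U, hU, hU'⟩
    exact ⟨_, _, two_le_card_connectedComponent hU, two_le_card_connectedComponent hU',
      contractsTo_completeBipartiteGraph_of_equiv hdiam2 U (Finite.equivFin _).symm
        (Finite.equivFin _).symm⟩
  · rintro ⟨k, l, hk, hl, h⟩
    have := Fin.nontrivial_iff_two_le.2 hk
    have := Fin.nontrivial_iff_two_le.2 hl
    exact hasDisconnectedCut_of_contractsTo h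

end Paper
end

section
/- Let G be a finite simple graph and let h≥2 be an integer. Let K1⋈G denote the graph obtained from G by adding one new vertex adjacent to all vertices of G. Then G has an independent set of size h if and only if K1⋈G is contractible to the star K_{1,h}. -/
namespace Paper

/-- The join `K1 ⋈ G` of a one-vertex graph with `G`: one new vertex is added
and made adjacent to all vertices of `G`. -/
def K1Join {V : Type} (G : SimpleGraph V) : SimpleGraph (Option V) :=
  SimpleGraph.fromRel (fun u v =>
    u = none ∨ ∃ a b : V, u = some a ∧ v = some b ∧ G.Adj a b)

theorem k1Join_adj_none_some {V : Type} (G : SimpleGraph V) (a : V) :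
    (K1Join G).Adj none (some a) := by
  simp [K1Join]

theorem k1Join_adj_some_some {V : Type} (G : SimpleGraph V) (a b : V) :
    (K1Join G).Adj (some a) (some b) ↔ G.Adj a b := by
  simp only [K1Join, SimpleGraph.fromRel_adj]
  constructor
  · rintro ⟨-, (h | ⟨c, d, hc, hd, hcd⟩) | (h | ⟨c, d, hc, hd, hcd⟩)⟩
    · cases h
    · cases hc; cases hd; exact hcd
    · cases h
    · cases hc; cases hd; exact hcd.symm
  · intro hab
    exact ⟨fun heq => hab.ne (Option.some.inj heq), Or.inl (Or.inr ⟨a, b, rfl, rfl, hab⟩)⟩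

/-- Any set containing the apex of a join `K1 ⋈ G` induces a connected subgraph. -/
theorem k1Join_induce_connected {V : Type} (G : SimpleGraph V) (S : Set (Option V))
    (hS : none ∈ S) : ((K1Join G).induce S).Connected := by
  have key : ∀ x : S, ((K1Join G).induce S).Reachable ⟨none, hS⟩ x := by
    rintro ⟨_ | a, hx⟩
    · exact SimpleGraph.Reachable.refl _
    · exact SimpleGraph.Adj.reachable (k1Join_adj_none_some G a)
  have : Nonempty S := ⟨⟨none, hS⟩⟩
  exact ⟨fun x y => (key x).symm.trans (key y)⟩

theorem contractsTo_star_of_injective {V : Type} (G : SimpleGraph V) {h : ℕ} (f : Fin h → V)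
    (hf : Function.Injective f) (hind : ∀ i j, ¬ G.Adj (f i) (f j)) :
    ContractsTo (K1Join G) (completeBipartiteGraph (Fin 1) (Fin h)) := by
  have hnone : none ∈ {v : Option V | ∀ i, v ≠ some (f i)} := fun i hi => by cases hi
  refine ⟨Sum.elim (fun _ => {v | ∀ i, v ≠ some (f i)}) (fun i => {some (f i)}), ?_, ?_, ?_⟩
  · rintro (c | i)
    · exact k1Join_induce_connected G _ hnone
    · change ((K1Join G).induce {some (f i)}).Connected
      have : Nonempty ({some (f i)} : Set (Option V)) := ⟨⟨_, rfl⟩⟩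
      exact ⟨fun x y => Subsingleton.elim x y ▸ SimpleGraph.Reachable.refl x⟩
  · intro v
    by_cases hv : ∃ i, v = some (f i)
    · obtain ⟨i, rfl⟩ := hv
      refine ⟨Sum.inr i, rfl, ?_⟩
      rintro (c | j) hj
      · exact absurd rfl (hj i)
      · exact congrArg Sum.inr (hf (Option.some.inj hj)).symm
    · refine ⟨Sum.inl 0, fun i hi => hv ⟨i, hi⟩, ?_⟩
      rintro (c | j) hj
      · exact congrArg Sum.inl (Subsingleton.elim c 0)
      · exact absurd ⟨j, hj⟩ hv
  · rintro (c | i) (d | j) hxy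
    · exact absurd (congrArg Sum.inl (Subsingleton.elim c d)) hxy
    · exact iff_of_true ⟨none, hnone, _, rfl, k1Join_adj_none_some G _⟩ (by simp)
    · exact iff_of_true ⟨_, rfl, none, hnone, (k1Join_adj_none_some G _).symm⟩ (by simp)
    · refine iff_of_false ?_ (by simp)
      rintro ⟨_, rfl, _, rfl, hadj⟩
      exact hind i j ((k1Join_adj_some_some G _ _).1 hadj)

theorem exists_injective_of_contractsTo_star {V : Type} (G : SimpleGraph V) {h : ℕ}
    (hh : 2 ≤ h)
    (hc : ContractsTo (K1Join G) (completeBipartiteGraph (Fin 1) (Fin h))) :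
    ∃ f : Fin h → V, Function.Injective f ∧ ∀ i j, ¬ G.Adj (f i) (f j) := by
  obtain ⟨P, hconn, huniq, hadj⟩ := hc
  have heq : ∀ {v x y}, v ∈ P x → v ∈ P y → x = y := fun {v _ _} hx hy =>
    (huniq v).unique hx hy
  have hnot : ∀ i j : Fin h, i ≠ j → ∀ u ∈ P (Sum.inr i), ∀ v ∈ P (Sum.inr j),
      ¬ (K1Join G).Adj u v := by
    intro i j hij u hu v hv huv
    have := (hadj (Sum.inr i) (Sum.inr j) (fun e => hij (Sum.inr.inj e))).1 ⟨u, hu, v, hv, huv⟩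
    simp at this
  have hsome : ∀ i : Fin h, ∃ a : V, some a ∈ P (Sum.inr i) := by
    intro i
    have hn : none ∉ P (Sum.inr i) := by
      intro hi
      have : Nontrivial (Fin h) := Fin.nontrivial_iff_two_le.2 hh
      obtain ⟨j, hj⟩ := exists_ne i
      obtain ⟨⟨_ | a, ha⟩⟩ := (hconn (Sum.inr j)).nonempty
      · exact hj (Sum.inr.inj (heq ha hi))
      · exact hnot i j hj.symm _ hi _ ha (k1Join_adj_none_some G a)
    obtain ⟨⟨_ | a, ha⟩⟩ := (hconn (Sum.inr i)).nonempty
    · exact absurd ha hn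
    · exact ⟨a, ha⟩
  choose f hf using hsome
  refine ⟨f, fun i j hij => Sum.inr.inj (heq (hf i) (hij ▸ hf j)), fun i j hG => ?_⟩
  rcases eq_or_ne i j with rfl | hij
  · exact G.irrefl hG
  · exact hnot i j hij _ (hf i) _ (hf j) ((k1Join_adj_some_some G _ _).2 hG)

/-- For `h ≥ 2`, a finite simple graph `G` has an independent set of size `h`
iff `K1 ⋈ G` is contractible to the star `K_{1,h}`. -/
theorem stmt18 {V : Type} [Fintype V] (G : SimpleGraph V) (h : ℕ) (hh : 2 ≤ h) :
    (∃ s : Finset V, s.card = h ∧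
        ∀ a ∈ s, ∀ b ∈ s, a ≠ b → ¬ G.Adj a b) ↔
      ContractsTo (K1Join G) (completeBipartiteGraph (Fin 1) (Fin h)) := by
  constructor
  · rintro ⟨s, hs, hind⟩
    let e : Fin h ≃ s := (s.equivFinOfCardEq hs).symm
    refine contractsTo_star_of_injective G (fun i => (e i : V))
      (Subtype.val_injective.comp e.injective) fun i j hG => ?_
    exact hind _ (e i).2 _ (e j).2 hG.ne hG
  · intro hc
    obtain ⟨f, hf, hind⟩ := exists_injective_of_contractsTo_star G hh hc
    refine ⟨Finset.univ.map ⟨f, hf⟩, by simp, ?_⟩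
    intro a ha b hb _
    obtain ⟨i, -, rfl⟩ := Finset.mem_map.1 ha
    obtain ⟨j, -, rfl⟩ := Finset.mem_map.1 hb
    exact hind i j

end Paper
end

section
/- Every finite connected simple graph of diameter at least 3 has a disconnected cut. -/
namespace Paper

/-- A vertex property invariant under adjacency separates vertices into different components. -/
lemma not_reachable_of_adj_invariant {W : Type*} {G : SimpleGraph W} {p : W → Prop}
    (hp : ∀ a b, G.Adj a b → p a → p b) {x y : W} (hx : p x) (hy : ¬ p y) :
    ¬ G.Reachable x y := by
  rintro ⟨w⟩
  induction w with
  | nil => exact hy hx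
  | cons h _ ih => exact ih (hp _ _ h hx) hy

lemma dist_le_dist_add_one_of_adj {W : Type*} {G : SimpleGraph W} (hc : G.Connected) (u : W)
    {a b : W} (h : G.Adj a b) : G.dist u b ≤ G.dist u a + 1 := by
  have := hc.dist_triangle (u := u) (v := a) (w := b)
  rwa [SimpleGraph.dist_eq_one_iff_adj.mpr h] at this

/-- In a connected graph every distance up to `G.dist u v` is attained from `u`. -/
lemma exists_dist_eq_of_le_dist {W : Type*} {G : SimpleGraph W} (hc : G.Connected) {u v : W}
    {n : ℕ} (hn : n ≤ G.dist u v) : ∃ w, G.dist u w = n := by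
  by_contra! h
  have hpos : 0 < n := by
    have := h u
    rw [SimpleGraph.dist_self] at this
    lia
  refine not_reachable_of_adj_invariant (p := fun w => G.dist u w < n) (fun a b hab ha => ?_)
    (by simpa using hpos) (not_lt.mpr hn) (hc.preconnected u v)
  have := dist_le_dist_add_one_of_adj hc u hab
  have := h b
  lia

/-- Every finite connected simple graph of diameter at least 3 has a
disconnected cut. -/
theorem stmt19 {V : Type} [Fintype V] (G : SimpleGraph V) (hc : G.Connected)
    (hdiam : ∃ u v : V, 3 ≤ G.dist u v) :
    HasDisconnectedCut G := by
  obtain ⟨u, v, huv⟩ := hdiam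
  obtain ⟨y, hy⟩ := exists_dist_eq_of_le_dist hc (n := 2) (by lia : 2 ≤ G.dist u v)
  obtain ⟨z, hz⟩ := exists_dist_eq_of_le_dist hc (n := 1) (by lia : 1 ≤ G.dist u v)
  refine ⟨{w | G.dist u w = 0 ∨ G.dist u w = 2},
    ⟨⟨u, by simp⟩, ⟨y, Or.inr hy⟩, ?_⟩,
    ⟨⟨z, by simp only [Set.mem_compl_iff, Set.mem_ofPred_eq]; lia⟩,
      ⟨v, by simp only [Set.mem_compl_iff, Set.mem_ofPred_eq]; lia⟩, ?_⟩⟩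
  · refine not_reachable_of_adj_invariant (p := fun w => G.dist u w.1 = 0) ?_ SimpleGraph.dist_self
      (by change ¬ G.dist u y = 0; lia)
    rintro ⟨a, ha⟩ ⟨b, hb⟩ hab hp
    have := dist_le_dist_add_one_of_adj hc u (SimpleGraph.comap_adj.mp hab)
    have hb' : G.dist u b = 0 ∨ G.dist u b = 2 := hb
    simp only [Function.Embedding.subtype_apply] at hp this ⊢
    lia
  · refine not_reachable_of_adj_invariant (p := fun w => G.dist u w.1 = 1) ?_ hz
      (by change ¬ G.dist u v = 1; lia)
    rintro ⟨a, ha⟩ ⟨b, hb⟩ hab hp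
    have := dist_le_dist_add_one_of_adj hc u (SimpleGraph.comap_adj.mp hab)
    have hb' : ¬ (G.dist u b = 0 ∨ G.dist u b = 2) := hb
    simp only [Function.Embedding.subtype_apply] at hp this ⊢
    lia

end Paper
end
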